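/- arXiv:1009.2119 — 3 statements merged into one kernel-verified Lean document; each statement's English description precedes it below -/
import Mathlib

section
/- If S ⊆ S_{m+1} is nonempty, then the spectral radius of the associated integral operator T on L²([0,1]^m) is strictly less than 1. -/
open MeasureTheory

noncomputable section

/-- The unit cube [0,1]^m. -/
def unitCube (m : ℕ) : Set (Fin m → ℝ) := Set.univ.pi fun _ => Set.Icc (0 : ℝ) 1

/-- Lebesgue measure restricted to the unit cube. -/
def cubeMeasure (m : ℕ) : Measure (Fin m → ℝ) := volume.restrict (unitCube m)

/-- The vector (t, x₁, …, x_{m-1}) obtained by shifting x and prepending t. -/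
def shiftIn {m : ℕ} (t : ℝ) (x : Fin m → ℝ) : Fin m → ℝ :=
  fun i => if i.val = 0 then t else x ⟨i.val - 1, by have := i.isLt; omega⟩

/-- `y` realizes (has standardization) the pattern `σ`. -/
def Realizes {k : ℕ} (y : Fin k → ℝ) (σ : Equiv.Perm (Fin k)) : Prop :=
  ∀ a b : Fin k, σ a < σ b ↔ y a < y b

open Classical in
/-- χ(x) = 1 iff the coordinates of x are pairwise distinct and its standardization
avoids S. -/
def chiS {m : ℕ} (S : Set (Equiv.Perm (Fin (m + 1)))) : (Fin (m + 1) → ℝ) → ℝ :=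
  fun y => if Function.Injective y ∧ ∀ σ ∈ S, ¬ Realizes y σ then 1 else 0

/-- The integral operator (Tf)(x₁,…,x_m) = ∫₀¹ χ(t,x₁,…,x_m) f(t,x₁,…,x_{m-1}) dt,
at the level of functions. -/
def TOp {m : ℕ} (χ : (Fin (m + 1) → ℝ) → ℝ) (f : (Fin m → ℝ) → ℝ) :
    (Fin m → ℝ) → ℝ :=
  fun x => ∫ t in Set.Icc (0 : ℝ) 1, χ (Fin.cons t x) * f (shiftIn t x)


open scoped ENNReal

/-- Lebesgue measure on the unit interval. -/
def unitMeas : Measure ℝ := volume.restrict (Set.Icc (0 : ℝ) 1)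

instance : IsProbabilityMeasure unitMeas := by
  constructor
  simp [unitMeas]

lemma cubeMeasure_eq_pi (m : ℕ) : cubeMeasure m = Measure.pi fun _ : Fin m => unitMeas := by
  unfold cubeMeasure unitCube unitMeas
  rw [volume_pi, Measure.restrict_pi_pi]

instance (m : ℕ) : IsProbabilityMeasure (cubeMeasure m) := by
  rw [cubeMeasure_eq_pi]; infer_instance

lemma measurable_shiftIn {m : ℕ} :
    Measurable (fun p : (Fin m → ℝ) × ℝ => shiftIn p.2 p.1) := by
  rw [measurable_pi_iff]
  intro i
  unfold shiftIn
  by_cases h : i.val = 0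
  · simp only [h, if_true]; exact measurable_snd
  · simp only [h, if_false]; fun_prop

lemma shiftIn_mp (m : ℕ) (hm : 1 ≤ m) :
    MeasurePreserving (fun p : (Fin m → ℝ) × ℝ => shiftIn p.2 p.1)
      ((cubeMeasure m).prod unitMeas) (cubeMeasure m) := by
  refine ⟨measurable_shiftIn, ?_⟩
  obtain ⟨n, rfl⟩ : ∃ n, m = n + 1 := ⟨m - 1, by omega⟩
  rw [cubeMeasure_eq_pi]
  symm
  apply Measure.pi_eq
  intro s hs
  rw [Measure.map_apply measurable_shiftIn (MeasurableSet.univ_pi hs)]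
  let u : Fin (n + 1) → Set ℝ := fun i =>
    if h : i.val + 1 < n + 1 then s ⟨i.val + 1, h⟩ else Set.univ
  have : (fun p : (Fin (n+1) → ℝ) × ℝ => shiftIn p.2 p.1) ⁻¹' (Set.univ.pi s)
      = (Set.univ.pi u) ×ˢ (s 0) := by
    ext ⟨x, t⟩
    simp only [Set.mem_preimage, Set.mem_pi, Set.mem_univ, true_imp_iff, Set.mem_prod]
    constructor
    · intro h
      refine ⟨fun i => ?_, ?_⟩
      · by_cases hi : i.val + 1 < n + 1
        · have := h ⟨i.val + 1, hi⟩
          simp only [u, hi, dif_pos]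
          simpa [shiftIn] using this
        · simp only [u, hi, dif_neg, not_false_iff, Set.mem_univ]
      · simpa [shiftIn] using h 0
    · rintro ⟨h1, h2⟩ i
      refine Fin.cases ?_ (fun j => ?_) i
      · simpa [shiftIn] using h2
      · have := h1 j.castSucc
        have hj : (j.castSucc : Fin (n+1)).val + 1 < n + 1 := by simp
        simp only [u, hj, dif_pos] at this
        exact this
  rw [this, Measure.prod_prod, Measure.pi_pi, Fin.prod_univ_castSucc, Fin.prod_univ_succ, mul_comm]
  congr 1
  have hl : unitMeas (u (Fin.last n)) = 1 := by simp [u]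
  rw [hl, mul_one]
  apply Finset.prod_congr rfl
  intro j _
  have hj : (j.castSucc : Fin (n+1)).val + 1 < n + 1 := by simp
  simp only [u, hj, dif_pos]
  rfl

/-- Cauchy-Schwarz. -/
lemma cs_sq {α : Type*} [MeasurableSpace α] (μ : Measure α) {f g : α → ℝ≥0∞}
    (hf : Measurable f) (hg : Measurable g) :
    (∫⁻ a, f a * g a ∂μ) ^ 2 ≤ (∫⁻ a, f a ^ 2 ∂μ) * ∫⁻ a, g a ^ 2 ∂μ := by
  have h := ENNReal.lintegral_mul_le_Lp_mul_Lq μ Real.HolderConjugate.two_two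
    hf.aemeasurable hg.aemeasurable
  simp only [Pi.mul_apply, ENNReal.rpow_two] at h
  calc _ ≤ _ := pow_le_pow_left₀ zero_le h 2
    _ = _ := by
      rw [mul_pow, ← ENNReal.rpow_two, ← ENNReal.rpow_two, ← ENNReal.rpow_mul, ← ENNReal.rpow_mul]
      norm_num

/-- The positive averaging operator. -/
def avg {m : ℕ} (F : (Fin m → ℝ) → ℝ≥0∞) : (Fin m → ℝ) → ℝ≥0∞ :=
  fun x => ∫⁻ t, F (shiftIn t x) ∂unitMeas

lemma avg_measurable {m : ℕ} {F : (Fin m → ℝ) → ℝ≥0∞} (hF : Measurable F) :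
    Measurable (avg F) := by
  unfold avg
  exact Measurable.lintegral_prod_right' (f := fun p : (Fin m → ℝ) × ℝ => F (shiftIn p.2 p.1))
    (hF.comp measurable_shiftIn)

lemma lintegral_shift {m : ℕ} (hm : 1 ≤ m) {F : (Fin m → ℝ) → ℝ≥0∞} (hF : Measurable F) :
    ∫⁻ x, ∫⁻ t, F (shiftIn t x) ∂unitMeas ∂(cubeMeasure m) = ∫⁻ x, F x ∂(cubeMeasure m) := by
  rw [← (shiftIn_mp m hm).lintegral_comp hF, lintegral_prod]
  exact (hF.comp measurable_shiftIn).aemeasurable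

lemma avg_sq {m : ℕ} (hm : 1 ≤ m) {F : (Fin m → ℝ) → ℝ≥0∞} (hF : Measurable F) :
    ∫⁻ x, avg F x ^ 2 ∂(cubeMeasure m) ≤ ∫⁻ x, F x ^ 2 ∂(cubeMeasure m) := by
  rw [← lintegral_shift hm (hF.pow_const 2)]
  apply lintegral_mono
  intro x
  have hs : Measurable fun t => F (shiftIn t x) :=
    hF.comp (measurable_shiftIn.comp (measurable_const.prodMk measurable_id))
  have := cs_sq unitMeas (measurable_const (a := (1 : ℝ≥0∞))) hs
  simpa [avg] using this

lemma avg_mono_ae {m : ℕ} (hm : 1 ≤ m) {F G : (Fin m → ℝ) → ℝ≥0∞}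
    (h : ∀ᵐ x ∂(cubeMeasure m), F x ≤ G x) :
    ∀ᵐ x ∂(cubeMeasure m), ∀ᵐ t ∂unitMeas, F (shiftIn t x) ≤ G (shiftIn t x) := by
  have h1 := (shiftIn_mp m hm).quasiMeasurePreserving.ae h
  exact Measure.ae_ae_of_ae_prod h1

lemma avg_dep {m : ℕ} {F : (Fin m → ℝ) → ℝ≥0∞} (j : ℕ)
    (h : ∀ x y : Fin m → ℝ, (∀ i, i.val < j + 1 → x i = y i) → F x = F y) :
    ∀ x y : Fin m → ℝ, (∀ i, i.val < j → x i = y i) → avg F x = avg F y := by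
  intro x y hxy
  unfold avg
  congr 1
  ext t
  apply h
  intro i hi
  unfold shiftIn
  split_ifs with h0
  · rfl
  · apply hxy
    simp only
    omega

lemma avg_iter_dep {m : ℕ} (F : (Fin m → ℝ) → ℝ≥0∞) (k : ℕ) : ∀ j, j + k = m →
    ∀ x y : Fin m → ℝ, (∀ i, i.val < j → x i = y i) → (avg^[k] F) x = (avg^[k] F) y := by
  induction k with
  | zero =>
    intro j hj x y h
    have : x = y := by
      ext i; exact h i (by omega)
    rw [this]
  | succ k ih =>
    intro j hj
    rw [Function.iterate_succ_apply']
    exact avg_dep j (ih (j + 1) (by omega))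

lemma avg_iter_meas {m : ℕ} {F : (Fin m → ℝ) → ℝ≥0∞} (hF : Measurable F) (k : ℕ) :
    Measurable (avg^[k] F) := by
  induction k with
  | zero => exact hF
  | succ k ih => rw [Function.iterate_succ_apply']; exact avg_measurable ih

lemma avg_iter_sq {m : ℕ} (hm : 1 ≤ m) {F : (Fin m → ℝ) → ℝ≥0∞} (hF : Measurable F) (k : ℕ) :
    ∫⁻ x, (avg^[k] F) x ^ 2 ∂(cubeMeasure m) ≤ ∫⁻ x, F x ^ 2 ∂(cubeMeasure m) := by
  induction k with
  | zero => exact le_rfl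
  | succ k ih =>
    rw [Function.iterate_succ_apply']
    exact (avg_sq hm (avg_iter_meas hF k)).trans ih

/-- A box of points realizing the pattern. -/
def goodBox {m : ℕ} (σ : Equiv.Perm (Fin (m + 1))) : Set ((Fin m → ℝ) × ℝ) :=
  (Set.univ.pi fun i : Fin m => Set.Ioo (((σ i.succ).val : ℝ) / (m + 1))
    ((((σ i.succ).val : ℝ) + 1) / (m + 1))) ×ˢ
    Set.Ioo (((σ 0).val : ℝ) / (m + 1)) ((((σ 0).val : ℝ) + 1) / (m + 1))

lemma goodBox_meas {m : ℕ} (σ : Equiv.Perm (Fin (m + 1))) : MeasurableSet (goodBox σ) :=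
  (MeasurableSet.univ_pi fun _ => measurableSet_Ioo).prod measurableSet_Ioo

lemma unitMeas_pos {m : ℕ} (k : Fin (m + 1)) :
    unitMeas (Set.Ioo ((k.val : ℝ) / (m + 1)) (((k.val : ℝ) + 1) / (m + 1))) ≠ 0 := by
  have hm : (0 : ℝ) < m + 1 := by positivity
  unfold unitMeas
  rw [Measure.restrict_apply measurableSet_Ioo, Set.inter_eq_left.2, Real.volume_Ioo]
  · rw [← sub_div]
    simp only [add_sub_cancel_left, ne_eq, ENNReal.ofReal_eq_zero, not_le]
    positivity
  · intro y hy
    have h1 : (0 : ℝ) ≤ (k.val : ℝ) / (m + 1) := by positivity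
    have h2 : ((k.val : ℝ) + 1) / (m + 1) ≤ 1 := by
      rw [div_le_one hm]
      exact_mod_cast k.isLt
    exact ⟨h1.trans hy.1.le, hy.2.le.trans h2⟩

lemma goodBox_pos {m : ℕ} (σ : Equiv.Perm (Fin (m + 1))) :
    ((cubeMeasure m).prod unitMeas) (goodBox σ) ≠ 0 := by
  unfold goodBox
  rw [Measure.prod_prod, cubeMeasure_eq_pi, Measure.pi_pi]
  exact mul_ne_zero (Finset.prod_ne_zero_iff.2 fun i _ => unitMeas_pos _) (unitMeas_pos _)

lemma goodBox_realizes {m : ℕ} (σ : Equiv.Perm (Fin (m + 1))) {x : Fin m → ℝ} {t : ℝ}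
    (h : (x, t) ∈ goodBox σ) : Realizes (Fin.cons t x : Fin (m + 1) → ℝ) σ := by
  have hm : (0 : ℝ) < m + 1 := by positivity
  obtain ⟨h1, h2⟩ := h
  have key : ∀ a : Fin (m + 1), (Fin.cons t x : Fin (m + 1) → ℝ) a ∈
      Set.Ioo (((σ a).val : ℝ) / (m + 1)) ((((σ a).val : ℝ) + 1) / (m + 1)) := by
    intro a
    refine Fin.cases ?_ (fun j => ?_) a
    · simpa using h2
    · simpa using h1 j (Set.mem_univ _)
  have mono : ∀ a b, σ a < σ b → (Fin.cons t x : Fin (m + 1) → ℝ) a < (Fin.cons t x : Fin (m + 1) → ℝ) b := by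
    intro a b hab
    refine (key a).2.trans_le (le_trans ?_ (key b).1.le)
    gcongr
    exact_mod_cast hab
  intro a b
  refine ⟨mono a b, fun hab => ?_⟩
  by_contra hn
  rcases (not_lt.1 hn).lt_or_eq with hlt | heq
  · exact lt_asymm hab (mono b a hlt)
  · rw [σ.injective heq] at hab
    exact lt_irrefl _ hab

lemma chi_le {m : ℕ} {S : Set (Equiv.Perm (Fin (m + 1)))} {σ : Equiv.Perm (Fin (m + 1))}
    (hσ : σ ∈ S) (x : Fin m → ℝ) (t : ℝ) :
    ‖chiS S (Fin.cons t x)‖ₑ ≤ (goodBox σ)ᶜ.indicator 1 (x, t) := by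
  by_cases h : (x, t) ∈ goodBox σ
  · have : chiS S (Fin.cons t x) = 0 := by
      unfold chiS
      rw [if_neg]
      rintro ⟨-, h2⟩
      exact h2 σ hσ (goodBox_realizes σ h)
    simp [this]
  · rw [Set.indicator_of_mem h]
    unfold chiS
    split_ifs <;> simp

lemma T_le {m : ℕ} {S : Set (Equiv.Perm (Fin (m + 1)))} {σ : Equiv.Perm (Fin (m + 1))}
    (hσ : σ ∈ S) (f : (Fin m → ℝ) → ℝ) (x : Fin m → ℝ) :
    ‖TOp (chiS S) f x‖ₑ ≤
      ∫⁻ t, (goodBox σ)ᶜ.indicator 1 (x, t) * ‖f (shiftIn t x)‖ₑ ∂unitMeas := by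
  unfold TOp
  refine (enorm_integral_le_lintegral_enorm _).trans (lintegral_mono fun t => ?_)
  rw [enorm_mul]
  gcongr
  exact chi_le hσ x t

lemma final_sq {m : ℕ} (hm : 1 ≤ m) (σ : Equiv.Perm (Fin (m + 1)))
    {F : (Fin m → ℝ) → ℝ≥0∞} (hF : Measurable F)
    (hd : ∀ x y : Fin m → ℝ, (∀ i, i.val < 1 → x i = y i) → F x = F y) :
    ∫⁻ x, (∫⁻ t, (goodBox σ)ᶜ.indicator 1 (x, t) * F (shiftIn t x) ∂unitMeas) ^ 2 ∂(cubeMeasure m)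
      ≤ ((cubeMeasure m).prod unitMeas) (goodBox σ)ᶜ * ∫⁻ x, F x ^ 2 ∂(cubeMeasure m) := by
  have hd' : ∀ x t, F (shiftIn t x) = F (shiftIn t 0) := by
    intro x t
    apply hd
    intro i hi
    simp [shiftIn, Nat.lt_one_iff.1 hi]
  have hs : Measurable fun t => F (shiftIn t 0) :=
    hF.comp (measurable_shiftIn.comp (measurable_const.prodMk measurable_id))
  have hI : ∫⁻ x, F x ^ 2 ∂(cubeMeasure m) = ∫⁻ t, F (shiftIn t 0) ^ 2 ∂unitMeas := by
    rw [← lintegral_shift hm (hF.pow_const 2)]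
    simp [hd']
  have hind : Measurable ((goodBox σ)ᶜ.indicator (1 : (Fin m → ℝ) × ℝ → ℝ≥0∞)) :=
    measurable_one.indicator (goodBox_meas σ).compl
  rw [hI, ← lintegral_indicator_one (goodBox_meas σ).compl, lintegral_prod _ hind.aemeasurable,
    ← lintegral_mul_const _ hind.lintegral_prod_right']
  apply lintegral_mono
  intro x
  simp only [hd' x]
  refine (cs_sq unitMeas (hind.comp (measurable_const.prodMk measurable_id)) hs).trans ?_
  gcongr with t
  simp only [Function.comp]
  by_cases h : (x, t) ∈ (goodBox σ)ᶜ <;> simp [h]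

lemma L2_enorm_sq {m : ℕ} (f : Lp ℝ 2 (cubeMeasure m)) :
    ‖f‖ₑ ^ 2 = ∫⁻ x, ‖f x‖ₑ ^ 2 ∂(cubeMeasure m) := by
  have := eLpNorm_nnreal_pow_eq_lintegral (f := f) (p := 2) (μ := cubeMeasure m) two_ne_zero
  rw [Lp.enorm_def]
  simpa using this

lemma T_pow_bound {m : ℕ} (hm : 1 ≤ m)
    {S : Set (Equiv.Perm (Fin (m + 1)))} {σ : Equiv.Perm (Fin (m + 1))} (hσ : σ ∈ S)
    (T : Lp ℝ 2 (cubeMeasure m) →L[ℝ] Lp ℝ 2 (cubeMeasure m))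
    (hT : ∀ f : Lp ℝ 2 (cubeMeasure m),
      (T f : (Fin m → ℝ) → ℝ) =ᵐ[cubeMeasure m] TOp (chiS S) f)
    (f : Lp ℝ 2 (cubeMeasure m)) (k : ℕ) :
    ∀ᵐ x ∂(cubeMeasure m), ‖(T ^ k) f x‖ₑ ≤ (avg^[k] fun x => ‖f x‖ₑ) x := by
  induction k with
  | zero => simp
  | succ k ih =>
    rw [Function.iterate_succ_apply', pow_succ']
    filter_upwards [hT ((T ^ k) f), avg_mono_ae hm ih] with x h1 h2
    rw [mul_apply_eq_comp, h1]
    refine (T_le hσ _ x).trans (lintegral_mono_ae ?_)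
    filter_upwards [h2] with t ht
    refine le_trans ?_ ht
    by_cases h : (x, t) ∈ (goodBox σ)ᶜ <;> simp [h]

lemma T_pow_sq {m : ℕ} (hm : 1 ≤ m)
    {S : Set (Equiv.Perm (Fin (m + 1)))} {σ : Equiv.Perm (Fin (m + 1))} (hσ : σ ∈ S)
    (T : Lp ℝ 2 (cubeMeasure m) →L[ℝ] Lp ℝ 2 (cubeMeasure m))
    (hT : ∀ f : Lp ℝ 2 (cubeMeasure m),
      (T f : (Fin m → ℝ) → ℝ) =ᵐ[cubeMeasure m] TOp (chiS S) f)
    (f : Lp ℝ 2 (cubeMeasure m)) :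
    ‖(T ^ (m - 1 + 1)) f‖ₑ ^ 2 ≤
      ((cubeMeasure m).prod unitMeas) (goodBox σ)ᶜ * ‖f‖ₑ ^ 2 := by
  have hF : Measurable fun x => ‖f x‖ₑ := (Lp.stronglyMeasurable f).enorm
  rw [L2_enorm_sq, L2_enorm_sq]
  refine le_trans ?_ ((final_sq hm σ (avg_iter_meas hF (m - 1))
    (avg_iter_dep _ (m - 1) 1 (by omega))).trans
    (mul_le_mul_right (avg_iter_sq hm hF (m - 1)) _))
  apply lintegral_mono_ae
  rw [pow_succ']
  filter_upwards [hT ((T ^ (m - 1)) f), avg_mono_ae hm (T_pow_bound hm hσ T hT f (m - 1))] with x h1 h2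
  rw [mul_apply_eq_comp, h1]
  gcongr
  refine (T_le hσ _ x).trans (lintegral_mono_ae ?_)
  filter_upwards [h2] with t ht
  gcongr

/-- if S ⊆ S_{m+1} is nonempty, then the spectral radius of the associated
operator T (realized as a bounded operator on the Hilbert space L²([0,1]^m) agreeing
a.e. with the integral formula) is strictly less than 1. -/
theorem spectralRadius_lt_one (m : ℕ) (hm : 2 ≤ m)
    (S : Set (Equiv.Perm (Fin (m + 1)))) (hS : S.Nonempty)
    (T : Lp ℝ 2 (cubeMeasure m) →L[ℝ] Lp ℝ 2 (cubeMeasure m))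
    (hT : ∀ f : Lp ℝ 2 (cubeMeasure m),
      (T f : (Fin m → ℝ) → ℝ) =ᵐ[cubeMeasure m] TOp (chiS S) f) :
    spectralRadius ℝ T < 1 := by
  obtain ⟨σ, hσ⟩ := hS
  have hm1 : 1 ≤ m := by omega
  set c := ((cubeMeasure m).prod unitMeas) (goodBox σ)ᶜ with hc
  have hc1 : c < 1 := by
    rw [hc, prob_compl_eq_one_sub (goodBox_meas σ)]
    exact ENNReal.sub_lt_self ENNReal.one_ne_top one_ne_zero (goodBox_pos σ)
  have hctop : c ≠ ∞ := (hc1.trans ENNReal.one_lt_top).ne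
  have hcr : c.toReal < 1 := by
    rw [← ENNReal.toReal_one]
    exact (ENNReal.toReal_lt_toReal hctop ENNReal.one_ne_top).2 hc1
  have hnorm : ‖T ^ (m - 1 + 1)‖ ≤ Real.sqrt c.toReal := by
    refine ContinuousLinearMap.opNorm_le_bound _ (Real.sqrt_nonneg _) fun f => ?_
    have h := T_pow_sq hm1 hσ T hT f
    have h' := ENNReal.toReal_mono
      (ENNReal.mul_ne_top hctop (ENNReal.pow_ne_top enorm_ne_top)) h
    rw [ENNReal.toReal_mul, ENNReal.toReal_pow, ENNReal.toReal_pow, toReal_enorm,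
      toReal_enorm] at h'
    refine (sq_le_sq₀ (norm_nonneg _) (by positivity)).1 ?_
    rw [mul_pow, Real.sq_sqrt ENNReal.toReal_nonneg]
    exact h'
  have hlt : ‖T ^ (m - 1 + 1)‖ < 1 :=
    hnorm.trans_lt (by rw [Real.sqrt_lt' one_pos]; simpa using hcr)
  refine (spectrum.spectralRadius_le_pow_nnnorm_pow_one_div ℝ T (m - 1)).trans_lt ?_
  have hpos : (0 : ℝ) < 1 / (((m - 1 : ℕ) : ℝ) + 1) := by positivity
  have h1 : (‖T ^ (m - 1 + 1)‖₊ : ℝ≥0∞) ^ (1 / (((m - 1 : ℕ) : ℝ) + 1)) < 1 := by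
    apply ENNReal.rpow_lt_one _ hpos
    exact_mod_cast hlt
  have h2 : (‖(1 : Lp ℝ 2 (cubeMeasure m) →L[ℝ] Lp ℝ 2 (cubeMeasure m))‖₊ : ℝ≥0∞)
      ^ (1 / (((m - 1 : ℕ) : ℝ) + 1)) ≤ 1 := by
    apply ENNReal.rpow_le_one _ hpos.le
    exact_mod_cast ContinuousLinearMap.norm_id_le
  calc _ ≤ _ := mul_le_mul_right h2 _
    _ < 1 := by rw [mul_one]; exact h1

end
end

section
/- The number of permutations of {1,…,n} avoiding both consecutive patterns 312 and 321 equals the number of involutions in S_n (permutations π with π∘π = id). Consequently, Σ_{n≥0} α_n({312,321}) z^n/n! = exp(z + z²/2). -/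
/-- π ∈ S_n avoids the consecutive patterns 312 and 321. -/
def Avoids312321 {n : ℕ} (π : Equiv.Perm (Fin n)) : Prop :=
  ∀ (i : ℕ) (h : i + 2 < n),
    -- no consecutive occurrence of 312: π(i+1) < π(i+2) < π(i)
    ¬(π ⟨i + 1, by omega⟩ < π ⟨i + 2, h⟩ ∧ π ⟨i + 2, h⟩ < π ⟨i, by omega⟩) ∧
    -- no consecutive occurrence of 321: π(i+2) < π(i+1) < π(i)
    ¬(π ⟨i + 2, h⟩ < π ⟨i + 1, by omega⟩ ∧ π ⟨i + 1, by omega⟩ < π ⟨i, by omega⟩)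

/-- The number of permutations of {1,…,n} avoiding 312 and 321 consecutively. -/
noncomputable def alpha312321 (n : ℕ) : ℕ :=
  Nat.card {π : Equiv.Perm (Fin n) // Avoids312321 π}

/-- Reversed avoidance for lists: in a window of three entries the last is never the largest. -/
def GoodList {α : Type*} [LinearOrder α] (l : List α) : Prop :=
  ∀ (i : ℕ) (h : i + 2 < l.length), ¬(l[i] < l[i+2] ∧ l[i+1] < l[i+2])

/-- The involution numbers. -/
def invNum : ℕ → ℕ
  | 0 => 1
  | 1 => 1
  | (n + 2) => invNum (n + 1) + (n + 1) * invNum n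

theorem eq_invNum {α : Type*} [LinearOrder α] (f : Finset α → ℕ) (h0 : f ∅ = 1)
    (h : ∀ s : Finset α, ∀ m ∈ s, (∀ x ∈ s, x ≤ m) →
      f s = f (s.erase m) + ∑ k ∈ s.erase m, f ((s.erase m).erase k)) :
    ∀ (n : ℕ) (s : Finset α), s.card = n → f s = invNum n := by
  intro n
  induction n using Nat.strong_induction_on with
  | _ n ih =>
    intro s hs
    match n, ih, hs with
    | 0, _, hs => rw [Finset.card_eq_zero.mp hs, h0]; rfl
    | 1, _, hs =>
      obtain ⟨a, rfl⟩ := Finset.card_eq_one.mp hs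
      rw [h {a} a (by simp) (by simp)]
      simp [h0, invNum]
    | n + 2, ih, hs =>
      have hne : s.Nonempty := Finset.card_pos.mp (by omega)
      have hm := s.max'_mem hne
      rw [h s (s.max' hne) hm (fun x hx => s.le_max' x hx)]
      have h1 : (s.erase (s.max' hne)).card = n + 1 := by
        rw [Finset.card_erase_of_mem hm, hs]; rfl
      rw [ih (n + 1) (by omega) _ h1, Finset.sum_congr rfl (g := fun _ => invNum n)]
      · simp [h1, invNum]
      · intro k hk
        apply ih n (by omega)
        rw [Finset.card_erase_of_mem hk, h1]; rfl

open Classical in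
/-- Good arrangements of a finite set. -/
noncomputable def arr {α : Type*} [LinearOrder α] (s : Finset α) : Finset (List α) :=
  (s.toList.permutations.toFinset).filter GoodList

theorem mem_arr {α : Type*} [LinearOrder α] (s : Finset α) (l : List α) :
    l ∈ arr s ↔ l.Nodup ∧ (∀ x, x ∈ l ↔ x ∈ s) ∧ GoodList l := by
  classical
  unfold arr
  rw [Finset.mem_filter, List.mem_toFinset, List.mem_permutations]
  constructor
  · rintro ⟨h, g⟩
    refine ⟨h.nodup_iff.mpr s.nodup_toList, fun x => ?_, g⟩
    rw [h.mem_iff]; simp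
  · rintro ⟨h, h2, g⟩
    refine ⟨?_, g⟩
    rw [List.perm_ext_iff_of_nodup h s.nodup_toList]
    intro x; rw [h2]; simp

theorem GoodList.tail {α : Type*} [LinearOrder α] {a : α} {l : List α} (h : GoodList (a :: l)) :
    GoodList l := by
  intro i hi
  have := h (i + 1) (by simp; omega)
  simpa using this

theorem GoodList.cons_max {α : Type*} [LinearOrder α] {m : α} {l : List α} (h : GoodList l)
    (hm : ∀ x ∈ l, x ≤ m) : GoodList (m :: l) := by
  intro i hi
  rcases i with _ | i
  · simp only [List.length_cons] at hi
    have := hm (l[1]) (List.getElem_mem _)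
    simp only [List.getElem_cons_zero, List.getElem_cons_succ]
    intro h; exact absurd h.1 (not_lt.mpr this)
  · have := h i (by simp at hi; omega)
    simpa using this

theorem GoodList.cons_cons_max {α : Type*} [LinearOrder α] {k m : α} {l : List α} (h : GoodList l)
    (hm : ∀ x ∈ l, x ≤ m) : GoodList (k :: m :: l) := by
  intro i hi
  rcases i with _ | i
  · simp only [List.length_cons] at hi
    have := hm (l[0]) (List.getElem_mem _)
    simp only [List.getElem_cons_zero, List.getElem_cons_succ]
    intro h; exact absurd h.2 (not_lt.mpr this)
  · have := h.cons_max hm i (by simp at hi ⊢; omega)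
    simpa using this

theorem arr_rec {α : Type*} [LinearOrder α] (s : Finset α) (m : α) (hm : m ∈ s)
    (hmax : ∀ x ∈ s, x ≤ m) :
    (arr s).card = (arr (s.erase m)).card +
      ∑ k ∈ s.erase m, (arr ((s.erase m).erase k)).card := by
  classical
  have key : arr s = (arr (s.erase m)).image (fun l => m :: l) ∪
      (s.erase m).biUnion (fun k => (arr ((s.erase m).erase k)).image (fun l => k :: m :: l)) := by
    ext l
    simp only [Finset.mem_union, Finset.mem_image, Finset.mem_biUnion]
    constructor
    · intro hl
      rw [mem_arr] at hl
      obtain ⟨hn, hx, hg⟩ := hl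
      match l, hn, hx, hg with
      | [], _, hx, _ => exact absurd ((hx m).2 hm) (by simp)
      | a :: t, hn, hx, hg =>
        by_cases ha : a = m
        · subst ha
          left
          refine ⟨t, (mem_arr _ _).2 ⟨(List.nodup_cons.1 hn).2, fun x => ?_, hg.tail⟩, rfl⟩
          have := hx x
          rw [List.nodup_cons] at hn
          rw [Finset.mem_erase, ← this, List.mem_cons]
          constructor
          · intro h; exact ⟨fun e => hn.1 (e ▸ h), Or.inr h⟩
          · rintro ⟨h1, h2⟩; exact h2.resolve_left h1
        · right
          match t, hn, hx, hg with
          | [], _, hx, _ => 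
            have := (hx m).2 hm
            simp at this; exact absurd this.symm ha
          | b :: t, hn, hx, hg =>
            by_cases hb : b = m
            · subst hb
              refine ⟨a, Finset.mem_erase.2 ⟨ha, (hx a).1 (by simp)⟩, t, (mem_arr _ _).2
                ⟨?_, fun x => ?_, hg.tail.tail⟩, rfl⟩
              · exact (List.nodup_cons.1 (List.nodup_cons.1 hn).2).2
              · have := hx x
                simp only [List.nodup_cons, List.mem_cons] at hn
                rw [Finset.mem_erase, Finset.mem_erase, ← this, List.mem_cons, List.mem_cons]
                constructor
                · intro h
                  exact ⟨fun e => hn.1 (Or.inr (e ▸ h)), fun e => hn.2.1 (e ▸ h), Or.inr (Or.inr h)⟩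
                · rintro ⟨h1, h2, h3⟩; exact (h3.resolve_left h1).resolve_left h2
            · exfalso
              have hmt : m ∈ t := by
                have := (hx m).2 hm
                simp only [List.mem_cons] at this
                rcases this with h | h | h
                · exact absurd h.symm ha
                · exact absurd h.symm hb
                · exact h
              obtain ⟨j, hj, hjm⟩ := List.getElem_of_mem hmt
              have hg' := hg j (by simp; omega)
              apply hg'
              have e : (a :: b :: t)[j + 2]'(by simp; omega) = m := by simpa using hjm
              rw [e]
              constructor
              · apply lt_of_le_of_ne (hmax _ ((hx _).1 (List.getElem_mem _)))
                rw [← e]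
                intro h
                have := (hn.getElem_inj_iff).1 h
                omega
              · apply lt_of_le_of_ne (hmax _ ((hx _).1 (List.getElem_mem _)))
                rw [← e]
                intro h
                have := (hn.getElem_inj_iff).1 h
                omega
    · rintro (⟨l', hl, rfl⟩ | ⟨k, hk, l', hl, rfl⟩)
      · rw [mem_arr] at hl ⊢
        obtain ⟨hn, hx, hg⟩ := hl
        refine ⟨List.nodup_cons.2 ⟨?_, hn⟩, fun x => ?_, hg.cons_max fun x h => ?_⟩
        · rw [hx]; simp
        · rw [List.mem_cons, hx, Finset.mem_erase]
          by_cases h : x = m <;> simp [h, hm]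
        · exact hmax x (Finset.mem_of_mem_erase ((hx x).1 h))
      · rw [mem_arr] at hl ⊢
        obtain ⟨hn, hx, hg⟩ := hl
        rw [Finset.mem_erase] at hk
        refine ⟨?_, fun x => ?_, hg.cons_cons_max fun x h => ?_⟩
        · simp only [List.nodup_cons, List.mem_cons, hx]
          simp [hn, hk.1]
        · rw [List.mem_cons, List.mem_cons, hx, Finset.mem_erase, Finset.mem_erase]
          by_cases h : x = m
          · simp [h, hm]
          · by_cases h' : x = k
            · simp [h', hk.2]
            · simp [h, h']
        · exact hmax x (Finset.mem_of_mem_erase (Finset.mem_of_mem_erase ((hx x).1 h)))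
  rw [key, Finset.card_union_of_disjoint, Finset.card_biUnion]
  · congr 1
    · exact Finset.card_image_of_injective _ (fun a b h => by simpa using h)
    · refine Finset.sum_congr rfl fun k _ => ?_
      exact Finset.card_image_of_injective _ (fun a b h => by simpa using h)
  · intro x _ y _ hxy
    change Disjoint _ _
    rw [Finset.disjoint_left]
    intro l h1 h2
    simp only [Finset.mem_image] at h1 h2
    obtain ⟨a, _, rfl⟩ := h1
    obtain ⟨b, _, hb⟩ := h2
    simp only [List.cons.injEq] at hb
    exact hxy hb.1.symm
  · rw [Finset.disjoint_left]
    intro l h1 h2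
    simp only [Finset.mem_image, Finset.mem_biUnion] at h1 h2
    obtain ⟨a, _, rfl⟩ := h1
    obtain ⟨k, hk, b, _, hb⟩ := h2
    simp only [List.cons.injEq] at hb
    exact (Finset.mem_erase.1 hk).1 hb.1

theorem arr_card {α : Type*} [LinearOrder α] (s : Finset α) : (arr s).card = invNum s.card := by
  refine eq_invNum (fun s => (arr s).card) ?_ arr_rec _ s rfl
  have : arr (∅ : Finset α) = {[]} := by
    ext l
    rw [mem_arr, Finset.mem_singleton]
    constructor
    · rintro ⟨_, h, _⟩
      apply List.eq_nil_iff_forall_not_mem.2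
      intro a ha
      exact absurd ((h a).1 ha) (by simp)
    · rintro rfl
      exact ⟨by simp, by simp, fun i h => absurd h (by simp)⟩
  rw [this]; rfl

theorem avoids_iff {n : ℕ} (π : Equiv.Perm (Fin n)) :
    Avoids312321 π ↔ GoodList (List.ofFn (fun j => π (Fin.rev j))) := by
  have E : ∀ i (h : i + 2 < n), ((¬(π ⟨i + 1, by omega⟩ < π ⟨i + 2, h⟩ ∧ π ⟨i + 2, h⟩ < π ⟨i, by omega⟩) ∧
    ¬(π ⟨i + 2, h⟩ < π ⟨i + 1, by omega⟩ ∧ π ⟨i + 1, by omega⟩ < π ⟨i, by omega⟩)) ↔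
    ¬ (π ⟨i + 2, h⟩ < π ⟨i, by omega⟩ ∧ π ⟨i + 1, by omega⟩ < π ⟨i, by omega⟩)) := by
    intro i h
    have : π ⟨i + 1, by omega⟩ ≠ π ⟨i + 2, h⟩ := by
      intro e; have := π.injective e; simp at this
    generalize π ⟨i + 1, by omega⟩ = a at *
    generalize π ⟨i + 2, by omega⟩ = b at *
    generalize π ⟨i, by omega⟩ = c at *
    omega
  constructor
  · intro h i hi
    have hi' : i + 2 < n := by simpa using hi
    have := (E (n - 3 - i) (by omega)).1 (h (n - 3 - i) (by omega))
    simp only [List.getElem_ofFn]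
    convert this using 5 <;> (first | rfl | (simp only [Fin.ext_iff, Fin.val_rev]; omega))
  · intro h i hi
    refine (E i hi).2 ?_
    have := h (n - 3 - i) (by simp; omega)
    simp only [List.getElem_ofFn] at this
    convert this using 5 <;> (first | rfl | (simp only [Fin.ext_iff, Fin.val_rev]; omega))

theorem alpha_eq (n : ℕ) : alpha312321 n = invNum n := by
  classical
  have h := arr_card (Finset.univ : Finset (Fin n))
  rw [Finset.card_fin] at h
  rw [← h, alpha312321, Nat.card_eq_fintype_card, Fintype.card_subtype]
  refine Finset.card_bij (fun π _ => List.ofFn (fun j => π (Fin.rev j))) ?_ ?_ ?_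
  · intro π hπ
    rw [mem_arr]
    refine ⟨?_, ?_, (avoids_iff π).1 (Finset.mem_filter.1 hπ).2⟩
    · rw [List.nodup_ofFn]
      exact π.injective.comp Fin.rev_injective
    · intro x
      simp only [Finset.mem_univ, iff_true, List.mem_ofFn]
      exact ⟨Fin.rev (π.symm x), by simp⟩
  · intro π _ σ _ h
    have h := List.ofFn_injective h
    ext j
    have := congrFun h (Fin.rev j)
    simp only [Fin.rev_rev] at this
    rw [this]
  · intro l hl
    rw [mem_arr] at hl
    obtain ⟨hn, hx, hg⟩ := hl
    have hlen : l.length = n := by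
      rw [← List.toFinset_card_of_nodup hn]
      have : l.toFinset = Finset.univ := by ext x; simp [hx]
      rw [this, Finset.card_fin]
    have hinj : Function.Injective
        (fun j : Fin n => l.get (Fin.cast hlen.symm (Fin.rev j))) :=
      (List.nodup_iff_injective_get.1 hn).comp
        ((Fin.cast_injective hlen.symm).comp Fin.rev_injective)
    let π : Equiv.Perm (Fin n) := Equiv.ofBijective _ (Finite.injective_iff_bijective.1 hinj)
    have hl : List.ofFn (fun j => π (Fin.rev j)) = l := by
      apply List.ext_getElem
      · simp [hlen]
      · intro i h1 h2
        simp [π]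
        congr 1
        omega
    refine ⟨π, Finset.mem_filter.2 ⟨Finset.mem_univ _, (avoids_iff π).2 ?_⟩, hl⟩
    rw [hl]; exact hg

open Classical in
/-- Involutions fixing everything outside a finite set. -/
noncomputable def invs {α : Type*} [Fintype α] (s : Finset α) : Finset (Equiv.Perm α) :=
  Finset.univ.filter (fun σ => (∀ x, σ (σ x) = x) ∧ ∀ x, x ∉ s → σ x = x)

theorem mem_invs {α : Type*} [Fintype α] (s : Finset α) (σ : Equiv.Perm α) :
    σ ∈ invs s ↔ (∀ x, σ (σ x) = x) ∧ ∀ x, x ∉ s → σ x = x := by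
  simp [invs]

theorem swap_mul_invs {α : Type*} [Fintype α] [LinearOrder α] (s : Finset α) (m k : α) (hm : m ∈ s)
    (hk : k ∈ s.erase m) (σ : Equiv.Perm α) :
    Equiv.swap m k * σ ∈ invs ((s.erase m).erase k) ↔ σ ∈ invs s ∧ σ m = k := by
  obtain ⟨hkm, hks⟩ := Finset.mem_erase.1 hk
  simp only [mem_invs, Equiv.Perm.mul_apply, Finset.mem_erase]
  constructor
  · rintro ⟨h1, h2⟩
    have e1 := h2 m (by simp)
    have e2 := h2 k (by simp)
    rw [Equiv.swap_apply_eq_iff, Equiv.swap_apply_left] at e1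
    rw [Equiv.swap_apply_eq_iff, Equiv.swap_apply_right] at e2
    refine ⟨⟨fun x => ?_, fun x hx => ?_⟩, e1⟩
    · by_cases hxm : x = m
      · rw [hxm, e1, e2]
      by_cases hxk : x = k
      · rw [hxk, e2, e1]
      have a1 : σ x ≠ m := fun h => hxk (σ.injective (h.trans e2.symm))
      have a2 : σ x ≠ k := fun h => hxm (σ.injective (h.trans e1.symm))
      have := h1 x
      rw [Equiv.swap_apply_of_ne_of_ne a1 a2, Equiv.swap_apply_eq_iff,
        Equiv.swap_apply_of_ne_of_ne hxm hxk] at this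
      exact this
    · have := h2 x (by tauto)
      rwa [Equiv.swap_apply_eq_iff, Equiv.swap_apply_of_ne_of_ne] at this
      · rintro rfl; exact hx hm
      · rintro rfl; exact hx hks
  · rintro ⟨⟨h1, h2⟩, e1⟩
    have e2 : σ k = m := by rw [← e1, h1]
    constructor
    · intro x
      by_cases hxm : x = m
      · rw [hxm, e1, Equiv.swap_apply_right, e1, Equiv.swap_apply_right]
      by_cases hxk : x = k
      · rw [hxk, e2, Equiv.swap_apply_left, e2, Equiv.swap_apply_left]
      have a1 : σ x ≠ m := fun h => hxk (σ.injective (h.trans e2.symm))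
      have a2 : σ x ≠ k := fun h => hxm (σ.injective (h.trans e1.symm))
      rw [Equiv.swap_apply_of_ne_of_ne a1 a2, h1, Equiv.swap_apply_of_ne_of_ne hxm hxk]
    · intro x hx
      by_cases hxm : x = m
      · rw [hxm, e1, Equiv.swap_apply_right]
      by_cases hxk : x = k
      · rw [hxk, e2, Equiv.swap_apply_left]
      rw [h2 x (by tauto), Equiv.swap_apply_of_ne_of_ne hxm hxk]

theorem invs_rec {α : Type*} [Fintype α] [LinearOrder α] (s : Finset α) (m : α) (hm : m ∈ s)
    (_hmax : ∀ x ∈ s, x ≤ m) :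
    (invs s).card = (invs (s.erase m)).card +
      ∑ k ∈ s.erase m, (invs ((s.erase m).erase k)).card := by
  classical
  have h1 : ∀ σ ∈ invs s, σ m ∈ s := by
    intro σ hσ
    rw [mem_invs] at hσ
    by_contra h
    have := hσ.2 _ h
    rw [hσ.1] at this
    exact h (this ▸ hm)
  rw [Finset.card_eq_sum_card_fiberwise h1, ← Finset.add_sum_erase _ _ hm]
  congr 1
  · congr 1
    ext σ
    simp only [Finset.mem_filter, mem_invs, Finset.mem_erase]
    constructor
    · rintro ⟨⟨h1, h2⟩, h3⟩
      refine ⟨h1, fun x hx => ?_⟩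
      by_cases e : x = m
      · rw [e, h3]
      · exact h2 x (by tauto)
    · rintro ⟨h1, h2⟩
      exact ⟨⟨h1, fun x hx => h2 x (by tauto)⟩, h2 m (by simp)⟩
  · refine Finset.sum_congr rfl fun k hk => ?_
    refine Finset.card_bij (fun σ _ => Equiv.swap m k * σ) ?_ ?_ ?_
    · intro σ hσ
      exact (swap_mul_invs s m k hm hk σ).2 (Finset.mem_filter.1 hσ)
    · intro σ _ τ _ h
      exact mul_left_cancel h
    · intro τ hτ
      have e : Equiv.swap m k * (Equiv.swap m k * τ) = τ := by
        rw [← mul_assoc, Equiv.swap_mul_self, one_mul]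
      refine ⟨Equiv.swap m k * τ, Finset.mem_filter.2 ?_, e⟩
      rw [← swap_mul_invs s m k hm hk, e]
      exact hτ

theorem inv_card (n : ℕ) :
    Nat.card {π : Equiv.Perm (Fin n) // ∀ x, π (π x) = x} = invNum n := by
  classical
  have h : (invs (Finset.univ : Finset (Fin n))).card = invNum n := by
    refine eq_invNum (fun s => (invs s).card) ?_ invs_rec _ _ (Finset.card_fin n)
    have : invs (∅ : Finset (Fin n)) = {1} := by
      ext σ
      rw [mem_invs, Finset.mem_singleton]
      constructor
      · rintro ⟨_, h⟩
        exact Equiv.ext fun x => h x (by simp)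
      · rintro rfl; simp
    rw [this]; rfl
  rw [← h, Nat.card_eq_fintype_card, Fintype.card_subtype]
  congr 1
  ext σ
  simp [mem_invs]

/-- The generating function. -/
noncomputable def gfun (z : ℂ) : ℂ := Complex.exp (z + z ^ 2 / 2)

theorem gfun_diff : ContDiff ℂ ⊤ gfun := by
  unfold gfun; fun_prop

theorem gfun_deriv (z : ℂ) : HasDerivAt gfun ((1 + z) * gfun z) z := by
  have h : HasDerivAt (fun z : ℂ => z + z ^ 2 / 2) (1 + z) z := by
    have h2 : HasDerivAt (fun z : ℂ => z ^ 2 / 2) z z := by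
      have h3 := (hasDerivAt_pow 2 z).div_const 2
      have e : ((2 : ℕ) : ℂ) * z ^ (2 - 1) / 2 = z := by norm_num
      rw [e] at h3
      exact h3
    exact (hasDerivAt_id z).add h2
  have := h.cexp
  rw [mul_comm] at this
  exact this

theorem gfun_hasDeriv (n : ℕ) (z : ℂ) :
    HasDerivAt (iteratedDeriv n gfun) (iteratedDeriv (n + 1) gfun z) z := by
  rw [iteratedDeriv_succ]
  exact ((gfun_diff.differentiable_iteratedDeriv n (by exact_mod_cast WithTop.coe_lt_top _)) z).hasDerivAt

theorem gfun_rec (n : ℕ) (z : ℂ) : iteratedDeriv (n + 2) gfun z =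
    (1 + z) * iteratedDeriv (n + 1) gfun z + (n + 1) * iteratedDeriv n gfun z := by
  have h1 : iteratedDeriv 1 gfun = fun z => (1 + z) * gfun z := by
    funext z; rw [iteratedDeriv_one]; exact (gfun_deriv z).deriv
  have hl : ∀ z : ℂ, HasDerivAt (fun z : ℂ => 1 + z) 1 z := fun z => (hasDerivAt_id z).const_add 1
  induction n generalizing z with
  | zero =>
    have h := (hl z).mul (gfun_deriv z)
    rw [iteratedDeriv_succ, h1]
    rw [show (fun z => (1 + z) * gfun z) = (fun z : ℂ => 1 + z) * gfun from rfl, h.deriv]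
    simp; ring
  | succ n ih =>
    have e : iteratedDeriv (n + 2) gfun = fun z =>
      (1 + z) * iteratedDeriv (n + 1) gfun z + (n + 1) * iteratedDeriv n gfun z := funext ih
    have h := ((hl z).mul (gfun_hasDeriv (n + 1) z)).add
      ((gfun_hasDeriv n z).const_mul ((n : ℂ) + 1))
    have h2 := gfun_hasDeriv (n + 2) z
    rw [e] at h2
    rw [h2.unique h]
    push_cast; ring

theorem gfun_coeff (n : ℕ) : iteratedDeriv n gfun 0 = invNum n ∧
    iteratedDeriv (n + 1) gfun 0 = invNum (n + 1) := by
  induction n with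
  | zero =>
    have := (gfun_deriv 0).deriv
    simp [iteratedDeriv_one, this, invNum, gfun]
  | succ n ih =>
    refine ⟨ih.2, ?_⟩
    rw [gfun_rec, ih.1, ih.2, invNum]
    push_cast; ring

/-- α_n({312,321}) equals the number of involutions in S_n, and
consequently the exponential generating function is exp(z + z²/2). -/
theorem consecutive_avoid_312_321_eq_involutions :
    (∀ n : ℕ, alpha312321 n =
        Nat.card {π : Equiv.Perm (Fin n) // ∀ x, π (π x) = x}) ∧
    (∀ z : ℂ, ∑' n : ℕ, (alpha312321 n : ℂ) * z ^ n / (n.factorial : ℂ) =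
        Complex.exp (z + z ^ 2 / 2)) := by
  refine ⟨fun n => by rw [alpha_eq, inv_card], fun z => ?_⟩
  have h := Complex.hasSum_taylorSeries_of_entire
    (f := gfun) (gfun_diff.differentiable (by simp)) 0 z
  change _ = gfun z
  rw [← h.tsum_eq]
  refine tsum_congr fun n => ?_
  rw [(gfun_coeff n).1, alpha_eq]
  simp only [sub_zero, smul_eq_mul]
  field_simp
end

section
/- For n ≥ 1, the n-th Euler number satisfies the convergent series expansion E_n/n! = 2·Σ_{j ≥ 1, j odd} (−1)^{((j−1)/2)·(n+1)} · (π·j/2)^{−n−1}. -/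
/-- The Euler (zigzag) number `E m`: the number of alternating permutations
τ ∈ S_m with τ(1) > τ(2) < τ(3) > ⋯ . -/
noncomputable def eulerNumber (m : ℕ) : ℕ :=
  Nat.card {τ : Equiv.Perm (Fin m) //
    ∀ (i : ℕ) (h : i + 1 < m),
      if i % 2 = 0 then τ ⟨i + 1, h⟩ < τ ⟨i, by omega⟩
      else τ ⟨i, by omega⟩ < τ ⟨i + 1, h⟩}

section EulerAux
open Finset

def Zig (s : ℕ) {m : ℕ} (τ : Equiv.Perm (Fin m)) : Prop :=
    ∀ (i : ℕ) (h : i + 1 < m),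
      if (i + s) % 2 = 0 then τ ⟨i + 1, h⟩ < τ ⟨i, by omega⟩
      else τ ⟨i, by omega⟩ < τ ⟨i + 1, h⟩

def entr : ℕ → ℕ → ℕ
  | 0, _ => 1
  | n+1, p => ∑ q ∈ range p, entr n (n - q)

def insPerm {n : ℕ} (p : Fin (n+1)) (σ : Equiv.Perm (Fin n)) : Equiv.Perm (Fin (n+1)) :=
  ((finSuccEquiv' 0).trans (Equiv.optionCongr σ)).trans (finSuccEquiv' p).symm

lemma insPerm_zero {n : ℕ} (p : Fin (n+1)) (σ : Equiv.Perm (Fin n)) : insPerm p σ 0 = p := by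
  simp [insPerm]

lemma insPerm_succ {n : ℕ} (p : Fin (n+1)) (σ : Equiv.Perm (Fin n)) (i : Fin n) :
    insPerm p σ i.succ = p.succAbove (σ i) := by
  have := finSuccEquiv'_succAbove (0 : Fin (n+1)) i
  rw [Fin.zero_succAbove] at this
  simp [insPerm, this]

lemma insPerm_inj {n : ℕ} (p : Fin (n+1)) : Function.Injective (insPerm p) := by
  intro σ σ' h
  ext i
  have := insPerm_succ p σ i
  rw [h, insPerm_succ] at this
  rw [Fin.succAbove_right_injective this]

lemma insPerm_surj {n : ℕ} (τ : Equiv.Perm (Fin (n+1))) : ∃ σ, insPerm (τ 0) σ = τ := by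
  have h : ∀ i : Fin n, ∃ j, (τ 0).succAbove j = τ i.succ := by
    intro i
    apply Fin.exists_succAbove_eq
    intro h
    exact Fin.succ_ne_zero i (τ.injective h)
  choose f hf using h
  have hi : Function.Injective f := by
    intro i j hij
    have : τ i.succ = τ j.succ := by rw [← hf, ← hf, hij]
    exact Fin.succ_injective _ (τ.injective this)
  refine ⟨Equiv.ofBijective f (Finite.injective_iff_bijective.mp hi), ?_⟩
  ext i
  refine Fin.cases ?_ (fun i => ?_) i
  · rw [insPerm_zero]
  · rw [insPerm_succ]; simp [hf]

lemma zig_ins {n : ℕ} (p : Fin (n+2)) (σ : Equiv.Perm (Fin (n+1))) :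
    Zig 0 (insPerm p σ) ↔ Zig 1 σ ∧ (σ 0 : ℕ) < p := by
  have h0 : insPerm p σ ⟨0, by omega⟩ = p := insPerm_zero p σ
  have h1 : ∀ i (h : i + 1 < n + 2), insPerm p σ ⟨i+1, h⟩ = p.succAbove (σ ⟨i, by omega⟩) :=
    fun i h => insPerm_succ p σ ⟨i, by omega⟩
  constructor
  · intro H
    constructor
    · intro i h
      have := H (i+1) (by omega)
      rw [h1, h1] at this
      simpa [Fin.succAbove_lt_succAbove_iff] using this
    · have := H 0 (by omega)
      rw [h1, h0] at this
      simp [Fin.succAbove_lt_iff_castSucc_lt] at this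
      exact this
  · rintro ⟨H, H'⟩ i h
    cases i with
    | zero =>
      rw [h1, h0]
      simp [Fin.succAbove_lt_iff_castSucc_lt]
      exact H'
    | succ i =>
      rw [h1, h1]
      have := H i (by omega)
      simpa [Fin.succAbove_lt_succAbove_iff] using this

lemma zig_rev {n : ℕ} (σ : Equiv.Perm (Fin n)) :
    Zig 1 (σ.trans Fin.revPerm) ↔ Zig 0 σ := by
  unfold Zig
  refine forall_congr' fun i => forall_congr' fun h => ?_
  rcases Nat.mod_two_eq_zero_or_one i with h | h
  · have : (i+1) % 2 = 1 := by omega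
    simp [h, this]
  · have : (i+1) % 2 = 0 := by omega
    simp [h, this]

open Classical in
lemma card_zig (n : ℕ) (p : Fin (n+1)) :
    #{τ : Equiv.Perm (Fin (n+1)) | Zig 0 τ ∧ τ 0 = p} = entr n p := by
  induction n with
  | zero =>
    haveI : Subsingleton (Fin (0+1)) := inferInstanceAs (Subsingleton (Fin 1))
    rw [entr, Finset.card_eq_one]
    refine ⟨1, ?_⟩
    ext τ
    simp only [mem_filter, mem_univ, true_and, mem_singleton]
    constructor
    · intro _; exact Subsingleton.elim _ _
    · rintro rfl
      exact ⟨fun i h => by omega, Subsingleton.elim _ _⟩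
  | succ n ih =>
    have e1 : #{τ : Equiv.Perm (Fin (n+2)) | Zig 0 τ ∧ τ 0 = p} =
        #{σ : Equiv.Perm (Fin (n+1)) | Zig 0 σ ∧ n - (σ 0 : ℕ) < p} := by
      symm
      apply Finset.card_bij (fun σ _ => insPerm p (σ.trans Fin.revPerm))
      · intro σ hσ
        simp only [mem_filter, mem_univ, true_and] at hσ ⊢
        rw [zig_ins, zig_rev]
        refine ⟨⟨hσ.1, ?_⟩, insPerm_zero _ _⟩
        simpa [Fin.val_rev] using hσ.2
      · intro σ _ σ' _ h
        have := insPerm_inj p h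
        ext i
        have := congrArg (fun e => e i) this
        simp at this
        rw [this]
      · intro τ hτ
        simp only [mem_filter, mem_univ, true_and] at hτ
        obtain ⟨σ, hσ⟩ := insPerm_surj τ
        rw [hτ.2] at hσ
        have hs : (σ.trans Fin.revPerm).trans Fin.revPerm = σ := by ext i; simp
        have := hτ.1
        rw [← hσ, zig_ins] at this
        refine ⟨σ.trans Fin.revPerm, ?_, ?_⟩
        · simp only [mem_filter, mem_univ, true_and]
          rw [← zig_rev, hs]
          refine ⟨this.1, ?_⟩
          have h3 := this.2
          simp [Fin.val_rev]
          omega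
        · rw [hs, hσ]
    rw [e1, entr]
    rw [Finset.card_eq_sum_card_fiberwise (f := fun σ => n - (σ 0 : ℕ)) (t := range p)]
    · refine Finset.sum_congr rfl fun q hq => ?_
      have hq := mem_range.mp hq
      have hp := p.2
      rw [← ih ⟨n - q, by omega⟩, Finset.filter_filter]
      congr 1
      ext σ
      simp only [mem_filter, mem_univ, true_and, Fin.ext_iff]
      have := (σ 0).2
      constructor
      · rintro ⟨⟨a, b⟩, c⟩; exact ⟨a, by omega⟩
      · rintro ⟨a, b⟩; exact ⟨⟨a, by omega⟩, by omega⟩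
    · intro σ hσ
      simp at hσ ⊢
      exact hσ.2

open Classical in
lemma euler_entr (n : ℕ) : eulerNumber (n+1) = entr (n+1) (n+1) := by
  have : eulerNumber (n+1) = #{τ : Equiv.Perm (Fin (n+1)) | Zig 0 τ} := by
    rw [eulerNumber, Nat.card_eq_fintype_card, Fintype.card_subtype]
    rfl
  rw [this, entr, Finset.card_eq_sum_card_fiberwise (f := fun σ => σ 0) (t := univ)]
  · simp_rw [Finset.filter_filter, card_zig]
    rw [Fin.sum_univ_eq_sum_range (fun i => entr n i), ← Finset.sum_range_reflect]
    simp
  · simp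
noncomputable def fpoly (n : ℕ) : Polynomial ℝ :=
  ∑ p ∈ range (n+1), Polynomial.C ((entr n p : ℝ) / (n.factorial : ℝ)) * bernsteinPolynomial ℝ n p

lemma fpoly_zero : fpoly 0 = 1 := by
  simp [fpoly, entr, bernsteinPolynomial]

lemma fpoly_eval_zero (n : ℕ) : (fpoly (n+1)).eval 0 = 0 := by
  rw [fpoly, Polynomial.eval_finsetSum]
  refine Finset.sum_eq_zero fun p _ => ?_
  rw [Polynomial.eval_mul, bernsteinPolynomial.eval_at_0]
  split_ifs with h
  · simp [h, entr]
  · simp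

lemma fpoly_eval_one (n : ℕ) : (fpoly n).eval 1 = (entr n n : ℝ) / n.factorial := by
  rw [fpoly, Polynomial.eval_finsetSum]
  rw [Finset.sum_eq_single n]
  · simp [bernsteinPolynomial.eval_at_1]
  · intro p _ hp
    simp [bernsteinPolynomial.eval_at_1, hp]
  · simp

lemma fpoly_deriv (n : ℕ) :
    Polynomial.derivative (fpoly (n+1)) = (fpoly n).comp (1 - Polynomial.X) := by
  have hR : (fpoly n).comp (1 - Polynomial.X) = ∑ p ∈ range (n+1),
      Polynomial.C ((entr n (n - p) : ℝ) / (n.factorial : ℝ)) * bernsteinPolynomial ℝ n p := by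
    rw [fpoly, Polynomial.sum_comp, ← Finset.sum_range_reflect]
    refine Finset.sum_congr rfl fun p hp => ?_
    have hp := mem_range.mp hp
    rw [Polynomial.mul_comp, Polynomial.C_comp, bernsteinPolynomial.flip _ _ _ (by omega)]
    have : n - (n + 1 - 1 - p) = p := by omega
    rw [this]
    simp
  rw [hR, fpoly, Polynomial.derivative_sum, Finset.sum_range_succ']
  have h0 : entr (n+1) 0 = 0 := by simp [entr]
  simp only [Polynomial.derivative_C_mul, bernsteinPolynomial.derivative_succ, h0]
  have key : ∀ c : ℕ → ℝ, c 0 = 0 →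
      ∑ p ∈ range (n+1), Polynomial.C (c (p+1)) * bernsteinPolynomial ℝ n (p+1) =
      ∑ p ∈ range (n+1), Polynomial.C (c p) * bernsteinPolynomial ℝ n p := by
    intro c hc
    have h1 := Finset.sum_range_succ' (fun p => Polynomial.C (c p) * bernsteinPolynomial ℝ n p) (n+1)
    rw [Finset.sum_range_succ, bernsteinPolynomial.eq_zero_of_lt ℝ (Nat.lt_succ_self n)] at h1
    simpa [hc] using h1.symm
  have k1 := key (fun p => (entr (n+1) p : ℝ) / n.factorial) (by simp [h0])
  have : ∀ p ∈ range (n+1), Polynomial.C ((entr n (n - p) : ℝ) / (n.factorial : ℝ)) *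
      bernsteinPolynomial ℝ n p =
      Polynomial.C ((entr (n+1) (p+1) : ℝ) / (n.factorial : ℝ)) * bernsteinPolynomial ℝ n p
      - Polynomial.C ((entr (n+1) p : ℝ) / (n.factorial : ℝ)) * bernsteinPolynomial ℝ n p := by
    intro p _
    have : entr (n+1) (p+1) = entr (n+1) p + entr n (n-p) := by
      simp only [entr]; rw [Finset.sum_range_succ]
    rw [← sub_mul, ← Polynomial.C_sub, this]
    congr 2
    push_cast; ring
  rw [Finset.sum_congr rfl this, Finset.sum_sub_distrib, ← k1, ← Finset.sum_sub_distrib]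
  simp only [Nat.cast_zero, zero_div, Polynomial.C_0, zero_mul, add_zero]
  refine Finset.sum_congr rfl fun p _ => ?_
  have hc : (entr (n+1) (p+1) : ℝ) / (n.factorial : ℝ) =
      (entr (n+1) (p+1) : ℝ) / ((n+1).factorial : ℝ) * ((n+1 : ℕ) : ℝ) := by
    rw [Nat.factorial_succ]
    have := Nat.factorial_ne_zero n
    push_cast
    field_simp
  rw [hc, Polynomial.C_mul, Polynomial.C_eq_natCast]
  simp only [Nat.add_sub_cancel]
  push_cast
  ring

noncomputable def lam (k : ℕ) : ℝ := Real.pi * (2 * (k : ℝ) + 1) / 2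

lemma lam_pos (k : ℕ) : 0 < lam k := by
  unfold lam; have := Real.pi_pos; positivity

lemma sin_lam (k : ℕ) : Real.sin (lam k) = (-1)^k := by
  have : lam k = Real.pi / 2 + k * Real.pi := by unfold lam; ring
  rw [this, Real.sin_add_nat_mul_pi]; simp

lemma cos_lam (k : ℕ) : Real.cos (lam k) = 0 := by
  have : lam k = Real.pi / 2 + k * Real.pi := by unfold lam; ring
  rw [this, Real.cos_add_nat_mul_pi]; simp

lemma sin_refl (k : ℕ) (x : ℝ) : Real.sin (lam k * (1 - x)) = (-1)^k * Real.cos (lam k * x) := by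
  rw [mul_sub, mul_one, Real.sin_sub, sin_lam, cos_lam]; ring

lemma cos_refl (k : ℕ) (x : ℝ) : Real.cos (lam k * (1 - x)) = (-1)^k * Real.sin (lam k * x) := by
  rw [mul_sub, mul_one, Real.cos_sub, sin_lam, cos_lam]; ring

lemma summable_lam (n : ℕ) : Summable fun k : ℕ => (lam k ^ (n+2))⁻¹ := by
  have h := (summable_nat_add_iff 1).mpr (Real.summable_nat_pow_inv.mpr (show 1 < n+2 by omega))
  refine Summable.of_nonneg_of_le (fun k => by have := lam_pos k; positivity) (fun k => ?_) h
  have : ((k+1 : ℕ) : ℝ) ≤ lam k := by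
    unfold lam
    push_cast
    have := Real.pi_gt_three
    have : (0:ℝ) ≤ k := by positivity
    nlinarith
  gcongr

lemma hasSum_of_eq {f g : ℕ → ℝ} {a : ℝ} (h : ∀ k, f k = g k) (H : HasSum f a) : HasSum g a := by
  rwa [← funext h]

lemma base (x : ℝ) (hx : x ∈ Set.Icc (0:ℝ) 1) :
    HasSum (fun k : ℕ => 2 * ((-1)^k * (lam k ^ 2)⁻¹ * Real.sin (lam k * x))) x := by
  have e : ∀ y, (Polynomial.map (algebraMap ℚ ℝ) (Polynomial.bernoulli (2 * 1))).eval y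
      = y^2 - y + 1/6 := by
    intro y
    simp [Polynomial.bernoulli, Finset.sum_range_succ, bernoulli, bernoulli'_two,
      Polynomial.eval_monomial]
    ring
  have H1 := hasSum_one_div_nat_pow_mul_cos (k := 1) one_ne_zero (x := (1-x)/4)
    ⟨by linarith [hx.2], by linarith [hx.1]⟩
  have H2 := hasSum_one_div_nat_pow_mul_cos (k := 1) one_ne_zero (x := (1-x)/2)
    ⟨by linarith [hx.2], by linarith [hx.1]⟩
  rw [e] at H1 H2
  have hinj : Function.Injective (fun k : ℕ => 2 * k + 1) := fun a b h => by
    simpa using h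
  have hs := H1.summable.comp_injective hinj
  have H3 := HasSum.even_add_odd (f := fun n : ℕ => 1 / (n : ℝ) ^ (2 * 1) *
    Real.cos (2 * Real.pi * n * ((1-x)/4))) (m := _) (m' := _)
    (by
      refine hasSum_of_eq (fun k => ?_) (H2.mul_left (1/4))
      push_cast
      rw [show 2 * Real.pi * (2 * (k:ℝ)) * ((1-x)/4) = 2 * Real.pi * k * ((1-x)/2) by ring]
      ring) hs.hasSum
  have H4 := H1.unique H3
  have H5 := hs.hasSum.mul_left (8 / Real.pi^2)
  have hp := Real.pi_ne_zero
  have hv : 8 / Real.pi^2 * ∑' b : ℕ, ((fun n : ℕ => 1 / (n : ℝ) ^ (2 * 1) *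
      Real.cos (2 * Real.pi * n * ((1-x)/4))) ∘ fun k => 2 * k + 1) b = x := by
    rw [← sub_eq_iff_eq_add'] at H4
    rw [← H4]
    simp
    field_simp
    ring
  rw [hv] at H5
  refine hasSum_of_eq (fun k => ?_) H5
  · symm
    rw [mul_assoc, mul_left_comm ((-1 : ℝ)^k), ← cos_refl]
    simp only [Function.comp]
    push_cast
    rw [show 2 * Real.pi * (2 * (k:ℝ) + 1) * ((1-x)/4) = lam k * (1 - x) by unfold lam; ring]
    unfold lam
    have : (2 * (k:ℝ) + 1) ≠ 0 := by positivity
    field_simp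
    try ring

lemma series (n : ℕ) : ∀ x ∈ Set.Icc (0:ℝ) 1, (fpoly (n+1)).eval x =
    ∑' k : ℕ, 2 * ((-1)^(k*(n+1)) * (lam k ^ (n+2))⁻¹ * Real.sin (lam k * x)) := by
  induction n with
  | zero =>
    have hd : ∀ x : ℝ, HasDerivAt (fun x => (fpoly 1).eval x) 1 x := by
      intro x
      have := (fpoly 1).hasDerivAt x
      rw [fpoly_deriv, fpoly_zero] at this
      simpa using this
    intro x hx
    have h1 : (fpoly 1).eval x = x :=
      eq_of_has_deriv_right_eq (f' := fun _ => 1) (a := 0) (b := 1)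
        (fun y _ => (hd y).hasDerivWithinAt) (fun y _ => (hasDerivAt_id y).hasDerivWithinAt)
        (fpoly 1).continuous.continuousOn continuousOn_id (fpoly_eval_zero 0) x hx
    rw [zero_add, h1]
    refine (base x hx).tsum_eq.symm.trans ?_
    simp
  | succ n ih =>
    have hg : ∀ y : ℝ, HasDerivAt
        (fun z => ∑' k : ℕ, 2 * ((-1)^(k*(n+1+1)) * (lam k ^ (n+1+2))⁻¹ * Real.sin (lam k * z)))
        (∑' k : ℕ, 2 * ((-1)^(k*(n+1)) * (lam k ^ (n+2))⁻¹ * Real.sin (lam k * (1 - y)))) y := by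
      intro y
      refine hasDerivAt_tsum (y₀ := 0) (u := fun k => 2 * (lam k ^ (n+2))⁻¹)
        (g' := fun k y => 2 * ((-1)^(k*(n+1)) * (lam k ^ (n+2))⁻¹ * Real.sin (lam k * (1 - y))))
        ((summable_lam n).mul_left 2) ?_ ?_ ?_ y
      · intro k z
        have h := (((hasDerivAt_id z).const_mul (lam k)).sin.const_mul
          ((-1)^(k*(n+1+1)) * (lam k ^ (n+1+2))⁻¹)).const_mul 2
        refine HasDerivAt.congr_deriv h ?_
        simp only [id]
        rw [sin_refl]
        have := (lam_pos k).ne'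
        rw [show k * (n+1+1) = k * (n+1) + k by ring, pow_add]
        field_simp
        ring
      · intro k z
        have := lam_pos k
        rw [norm_mul, norm_mul, norm_mul, norm_pow]
        simp only [Real.norm_eq_abs, abs_neg, abs_one, one_pow, one_mul, abs_two]
        rw [abs_of_pos (by positivity : 0 < (lam k ^ (n+2))⁻¹)]
        have h1 := Real.abs_sin_le_one (lam k * (1 - z))
        have : 0 < (lam k ^ (n+2))⁻¹ := by positivity
        nlinarith
      · simp
    have hf : ∀ y : ℝ, HasDerivAt (fun z => (fpoly (n+1+1)).eval z) ((fpoly (n+1)).eval (1-y)) y := by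
      intro y
      have := (fpoly (n+1+1)).hasDerivAt y
      rw [fpoly_deriv] at this
      simpa using this
    refine eq_of_has_deriv_right_eq (f' := fun y => (fpoly (n+1)).eval (1-y)) 
      (fun y _ => (hf y).hasDerivWithinAt) (fun y hy => ?_) 
      (fpoly _).continuous.continuousOn (fun y _ => (hg y).continuousAt.continuousWithinAt) ?_
    · rw [ih (1-y) ⟨by linarith [hy.2], by linarith [hy.1]⟩]
      exact (hg y).hasDerivWithinAt
    · simp [fpoly_eval_zero]

end EulerAux

/-- For n ≥ 1,
E_n/n! = 2 · Σ_{j ≥ 1 odd} (−1)^{((j−1)/2)·(n+1)} · (π·j/2)^{−n−1},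
where the sum over odd j = 2k+1 is indexed by k : ℕ. -/
theorem eulerNumber_series (n : ℕ) (hn : 1 ≤ n) :
    (eulerNumber n : ℝ) / (n.factorial : ℝ) =
      2 * ∑' k : ℕ,
        (-1 : ℝ) ^ (k * (n + 1)) *
          (Real.pi * (2 * (k : ℝ) + 1) / 2) ^ (-(n : ℤ) - 1) := by
  obtain ⟨m, rfl⟩ : ∃ m, n = m + 1 := ⟨n - 1, by omega⟩
  rw [euler_entr, ← fpoly_eval_one, series m 1 (by simp), tsum_mul_left]
  congr 1
  refine tsum_congr fun k => ?_
  rw [mul_one, sin_lam, mul_right_comm, ← pow_add]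
  congr 1
end
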